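/- Let T = {E₁, E₂, …, E_m} be a strongly independent system of word equations in n unknowns. Then m ≤ |E₁| + |E₂| + 2, and there exist indices 1 ≤ k < ℓ ≤ n such that m ≤ 2(|E₁|_{x_k} + |E₁|_{x_ℓ}) + 2. Moreover, if T has a solution of rank n−1, then m ≤ |E₁| + |E₂| + 1, and there exist indices 1 ≤ k < ℓ ≤ n such that m ≤ 2(|E₁|_{x_k} + |E₁|_{x_ℓ}) + 1. -/

import Mathlib

open scoped BigOperators

namespace WordEquations

/-- The set of letters occurring in the images of a (letter-image) morphism. -/
def alph {Ξ Δ : Type*} (h : Ξ → List Δ) : Set Δ := ⋃ x, {a | a ∈ h x}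

/-- `h` is a solution of the system `T` of word equations. -/
def IsSolution {Ξ A : Type*} (h : Ξ → List A) (T : Set (List Ξ × List Ξ)) : Prop :=
  ∀ e ∈ T, e.1.flatMap h = e.2.flatMap h

/-- `h` is a solution of the single word equation `E`. -/
def IsSolutionE {Ξ A : Type*} (h : Ξ → List A) (E : List Ξ × List Ξ) : Prop :=
  E.1.flatMap h = E.2.flatMap h

/-- `θ` is a renaming of letters on the set `S`: it maps each letter of `S` to a
single letter, injectively on `S`. -/
def IsRenamingOn {A B : Type*} (θ : A → List B) (S : Set A) : Prop :=
  (∀ a ∈ S, ∃ b, θ a = [b]) ∧ ∀ a₁ ∈ S, ∀ a₂ ∈ S, θ a₁ = θ a₂ → a₁ = a₂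

/-- `g` is a principal solution of `T`: whenever `g = θ ∘ g'` for a solution `g'`
(and a morphism `θ` non-erasing on `alph g'`), `θ` is a renaming of letters. -/
def IsPrincipalSolution {Ξ Δ : Type*} (g : Ξ → List Δ) (T : Set (List Ξ × List Ξ)) : Prop :=
  IsSolution g T ∧
  ∀ (Δ' : Type) (g' : Ξ → List Δ') (θ : Δ' → List Δ),
    IsSolution g' T → (∀ a ∈ alph g', θ a ≠ []) →
    (∀ x, g x = (g' x).flatMap θ) → IsRenamingOn θ (alph g')

/-- The vector `γ(h)_a = (|h(x₁)|_a, …, |h(xₙ)|_a) ∈ ℚⁿ`. -/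
def gamVec {n : ℕ} {Δ : Type*} [DecidableEq Δ] (h : Fin n → List Δ) (a : Δ) :
    Fin n → ℚ := fun j => ((h j).count a : ℚ)

/-- `Γ_h`, the ℚ-span of the vectors `γ(h)_a`. -/
noncomputable def GammaSpace {n : ℕ} {Δ : Type*} [DecidableEq Δ] (h : Fin n → List Δ) :
    Submodule ℚ (Fin n → ℚ) := Submodule.span ℚ (Set.range (gamVec h))

/-- The rank of a morphism: `dim Γ_h`. -/
noncomputable def morphRank {n : ℕ} {Δ : Type*} [DecidableEq Δ] (h : Fin n → List Δ) : ℕ :=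
  Module.finrank ℚ ↥(GammaSpace h)

/-- `Mℕ`: all finite nonempty sums `Σᵢ aᵢ αᵢ` with `aᵢ` positive integers and `αᵢ ∈ M`
(equivalently, nonempty finite sums of elements of `M` with repetitions). -/
def natSums {n : ℕ} (M : Set (Fin n → ℚ)) : Set (Fin n → ℚ) :=
  {v | ∃ l : List (Fin n → ℚ), l ≠ [] ∧ (∀ x ∈ l, x ∈ M) ∧ l.sum = v}

/-- `M ⊆ ℚⁿ` has rank `r`: the ℚ-span of `M` has dimension `r`, and `M` is not contained
in any finite union of `(r-1)`-dimensional subspaces of its span. -/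
def HasRank {n : ℕ} (M : Set (Fin n → ℚ)) (r : ℕ) : Prop :=
  Module.finrank ℚ ↥(Submodule.span ℚ M) = r ∧
  ∀ V : Finset (Submodule ℚ (Fin n → ℚ)),
    (∀ W ∈ V, W ≤ Submodule.span ℚ M ∧ Module.finrank ℚ ↥W + 1 = r) →
    ¬ M ⊆ ⋃ W ∈ V, (W : Set (Fin n → ℚ))

/-- The monomial `X^α = ∏ᵢ Xᵢ^{αᵢ}` in `ℤ[X₁,…,Xₙ]`. -/
noncomputable def Xpow {n : ℕ} (α : Fin n → ℕ) : MvPolynomial (Fin n) ℤ :=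
  ∏ i, MvPolynomial.X i ^ α i

/-- The polynomial `Σ_{a : w_a = j} ∏_{t<a} X_{w_t}` associated with one side of an equation. -/
noncomputable def sideS {n : ℕ} (w : List (Fin n)) (j : Fin n) : MvPolynomial (Fin n) ℤ :=
  ∑ a : Fin w.length, if w.get a = j then ((w.take (a : ℕ)).map MvPolynomial.X).prod else 0

/-- The polynomial `S_{E,x_j}` of the equation `E = (u,v)`. -/
noncomputable def SE {n : ℕ} (E : List (Fin n) × List (Fin n)) (j : Fin n) :
    MvPolynomial (Fin n) ℤ :=
  sideS E.1 j - sideS E.2 j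

/-- Evaluation `p ↦ p(β)`, induced by `Xᵢ ↦ x^{βᵢ}`. -/
noncomputable def evalAt {n : ℕ} (β : Fin n → ℕ) (p : MvPolynomial (Fin n) ℤ) : Polynomial ℤ :=
  MvPolynomial.eval₂ (Int.castRingHom (Polynomial ℤ)) (fun i => Polynomial.X ^ β i) p

/-- `λ⁺`, the positive part of an integer vector. -/
def lamPos {n : ℕ} (lam : Fin n → ℤ) : Fin n → ℕ := fun i => (lam i).toNat

/-- `λ⁻`, the negative part of an integer vector. -/
def lamNeg {n : ℕ} (lam : Fin n → ℤ) : Fin n → ℕ := fun i => (-(lam i)).toNat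

/-- The length type `L(θ_α ∘ h)` of the composition of `h` with the power morphism
`θ_α : aᵢ ↦ aᵢ^{αᵢ}`. -/
def powLenType {n k : ℕ} (α : Fin k → ℕ) (h : Fin n → List (Fin k)) : Fin n → ℕ :=
  fun x => ∑ a, α a * (h x).count a

/-- The field `ℚ(x)`, realized as the field of fractions of `ℤ[x]`. -/
noncomputable abbrev RatX : Type := FractionRing (Polynomial ℤ)

/-- The vector `𝒮_E(β) ∈ ℚ(x)ⁿ`. -/
noncomputable def SEvec {n : ℕ} (E : List (Fin n) × List (Fin n)) (β : Fin n → ℕ) :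
    Fin n → RatX :=
  fun j => algebraMap (Polynomial ℤ) RatX (evalAt β (SE E j))

/-- The set of exponents of the minimal monomials of `p` (exponents in the support of `p`
that are minimal with respect to the componentwise order). -/
noncomputable def minimalSupport {n : ℕ} (p : MvPolynomial (Fin n) ℤ) : Finset (Fin n →₀ ℕ) :=
  p.support.filter (fun β => ∀ β' ∈ p.support, β' ≤ β → β' = β)


open MvPolynomial in
/-- Commutative Fox derivative of a word with respect to a letter. -/
noncomputable def fox {n : ℕ} : List (Fin n) → Fin n → MvPolynomial (Fin n) ℤ
  | [], _ => 0
  | c :: w, k => (if c = k then 1 else 0) + X c * fox w k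

/-- The commutative image of a word. -/
noncomputable def mono {n : ℕ} (w : List (Fin n)) : MvPolynomial (Fin n) ℤ :=
  (w.map MvPolynomial.X).prod

/-- The ring morphism induced by a word morphism. -/
noncomputable def star' {n c : ℕ} (h : Fin n → List (Fin c)) :
    MvPolynomial (Fin n) ℤ →ₐ[ℤ] MvPolynomial (Fin c) ℤ :=
  MvPolynomial.aeval (fun j => mono (h j))

lemma mono_append {n : ℕ} (u v : List (Fin n)) : mono (u ++ v) = mono u * mono v := by
  simp [mono]

lemma mono_cons {n : ℕ} (a : Fin n) (v : List (Fin n)) :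
    mono (a :: v) = MvPolynomial.X a * mono v := by
  simp [mono]

lemma mono_ne_zero {n : ℕ} (u : List (Fin n)) : mono u ≠ 0 := by
  induction u with
  | nil => simp [mono]
  | cons a u ih => rw [mono_cons]; exact mul_ne_zero (MvPolynomial.X_ne_zero a) ih

lemma fox_append {n : ℕ} (u v : List (Fin n)) (a : Fin n) :
    fox (u ++ v) a = fox u a + mono u * fox v a := by
  induction u with
  | nil => simp [mono, fox]
  | cons c u ih => simp only [List.cons_append, fox, ih, mono_cons]; ring

lemma star_X {n c : ℕ} (h : Fin n → List (Fin c)) (j : Fin n) :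
    star' h (MvPolynomial.X j) = mono (h j) := by simp [star']

lemma fox_flatMap {n c : ℕ} (h : Fin n → List (Fin c)) (u : List (Fin n)) (a : Fin c) :
    fox (u.flatMap h) a = ∑ j, star' h (fox u j) * fox (h j) a := by
  induction u with
  | nil => simp [fox]
  | cons b u ih =>
    rw [List.flatMap_cons, fox_append, ih]
    simp only [fox, map_add, map_mul, star_X, add_mul, Finset.sum_add_distrib]
    congr 1
    · rw [Finset.sum_eq_single b]
      · simp
      · intro j _ hj; simp [Ne.symm hj]
      · simp
    · rw [Finset.mul_sum]; exact Finset.sum_congr rfl (fun j _ => by ring)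

lemma fox_inj {n : ℕ} (u v : List (Fin n)) (h : ∀ a, fox u a = fox v a) : u = v := by
  induction u generalizing v with
  | nil =>
    cases v with
    | nil => rfl
    | cons b v =>
      have := congrArg MvPolynomial.constantCoeff (h b)
      simp [fox] at this
  | cons a u ih =>
    cases v with
    | nil =>
      have := congrArg MvPolynomial.constantCoeff (h a)
      simp [fox] at this
    | cons b v =>
      have h1 := congrArg MvPolynomial.constantCoeff (h b)
      have hab : a = b := by
        by_contra hne
        simp [fox, hne] at h1
      subst hab
      congr 1
      apply ih
      intro k
      have := h k
      simp only [fox] at this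
      exact mul_left_cancel₀ (MvPolynomial.X_ne_zero a) (add_left_cancel this)

/-- The vector of an equation. -/
noncomputable def vec {n : ℕ} (E : List (Fin n) × List (Fin n)) (k : Fin n) :
    MvPolynomial (Fin n) ℤ := fox E.1 k - fox E.2 k

lemma sol_iff {n c : ℕ} (h : Fin n → List (Fin c)) (E : List (Fin n) × List (Fin n)) :
    IsSolutionE h E ↔ ∀ a, ∑ j, star' h (vec E j) * fox (h j) a = 0 := by
  have key : ∀ a, ∑ j, star' h (vec E j) * fox (h j) a =
      fox (E.1.flatMap h) a - fox (E.2.flatMap h) a := by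
    intro a
    rw [fox_flatMap, fox_flatMap, ← Finset.sum_sub_distrib]
    exact Finset.sum_congr rfl (fun j _ => by simp [vec, sub_mul])
  simp only [key, sub_eq_zero]
  constructor
  · intro hs a; rw [hs]
  · intro hs; exact fox_inj _ _ hs

lemma eval_fox {n : ℕ} (w : List (Fin n)) (a : Fin n) :
    MvPolynomial.eval (fun _ => (1 : ℤ)) (fox w a) = w.count a := by
  induction w with
  | nil => simp [fox]
  | cons b w ih =>
    simp only [fox, map_add, map_mul, MvPolynomial.eval_X, ih, List.count_cons]
    by_cases hb : b = a <;> simp [hb]; ring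

/-- Membership in the kernel of the count matrix. -/
def Ker {n c : ℕ} (h : Fin n → List (Fin c)) (z : Fin n → ℚ) : Prop :=
  ∀ a, ∑ j, ((h j).count a : ℚ) * z j = 0

/-- The kernel is the line spanned by `lam`. -/
def Line {n c : ℕ} (h : Fin n → List (Fin c)) (lam : Fin n → ℚ) : Prop :=
  lam ≠ 0 ∧ Ker h lam ∧ ∀ z, Ker h z → ∃ t : ℚ, z = t • lam

lemma exists_line {n c : ℕ} (hn : 1 ≤ n) (h : Fin n → List (Fin c))
    (hr : morphRank h = n - 1) : ∃ lam, Line h lam := by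
  let M : Matrix (Fin c) (Fin n) ℚ := Matrix.of fun a j => ((h j).count a : ℚ)
  have h1 : M.rank = n - 1 := by
    rw [Matrix.rank_eq_finrank_span_row]; exact hr
  have h2 := LinearMap.finrank_range_add_finrank_ker M.mulVecLin
  have h3 : Module.finrank ℚ (LinearMap.ker M.mulVecLin) = 1 := by
    have : Module.finrank ℚ (LinearMap.range M.mulVecLin) = n - 1 := h1
    simp only [Module.finrank_fintype_fun_eq_card, Fintype.card_fin] at h2
    omega
  have hK : ∀ z, z ∈ LinearMap.ker M.mulVecLin ↔ Ker h z := by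
    intro z
    rw [LinearMap.mem_ker, funext_iff]
    rfl
  obtain ⟨v, hv, hv'⟩ := finrank_eq_one_iff'.1 h3
  refine ⟨v, by simpa using hv, (hK _).1 v.2, ?_⟩
  intro z hz
  obtain ⟨t, ht⟩ := hv' ⟨z, (hK z).2 hz⟩
  exact ⟨t, by simpa using (congrArg Subtype.val ht).symm⟩

lemma parallel {n c : ℕ} {h : Fin n → List (Fin c)} {lam : Fin n → ℚ} (hl : Line h lam)
    {α β : Fin n → MvPolynomial (Fin c) ℤ} (hα : ∀ a, ∑ j, α j * fox (h j) a = 0)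
    (hβ : ∀ a, ∑ j, β j * fox (h j) a = 0) (k l : Fin n) : α k * β l = α l * β k := by
  obtain ⟨hl0, -, hl2⟩ := hl
  obtain ⟨k0, hk0⟩ := Function.ne_iff.1 hl0
  let W : Matrix (Fin n) (Fin n) (MvPolynomial (Fin c) ℤ) := Matrix.of fun i j =>
    ∑ a, ((h i).count a : MvPolynomial (Fin c) ℤ) * fox (h j) a +
      if i = k0 then (if j = k0 then 1 else 0) else 0
  let φ : MvPolynomial (Fin c) ℤ →+* ℚ :=
    (Int.castRingHom ℚ).comp (MvPolynomial.eval (fun _ => (1 : ℤ)))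
  have hφ : ∀ j a, φ (fox (h j) a) = (h j).count a := by
    intro j a; simp [φ, eval_fox]
  have hW : ∀ z : Fin n → MvPolynomial (Fin c) ℤ, ∀ i, W.mulVec z i =
      ∑ a, ((h i).count a : MvPolynomial (Fin c) ℤ) * ∑ j, z j * fox (h j) a +
        if i = k0 then z k0 else 0 := by
    intro z i
    simp only [Matrix.mulVec, dotProduct, W, Matrix.of_apply, add_mul, Finset.sum_add_distrib]
    congr 1
    · simp only [Finset.sum_mul, Finset.mul_sum]
      rw [Finset.sum_comm]
      exact Finset.sum_congr rfl fun a _ => Finset.sum_congr rfl fun j _ => by ring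
    · by_cases hi : i = k0 <;> simp [hi]
  have hdet : W.det ≠ 0 := by
    intro h0
    have h1 : (φ.mapMatrix W).det = 0 := by rw [← RingHom.map_det, h0, map_zero]
    obtain ⟨z, hz, hz'⟩ := Matrix.exists_mulVec_eq_zero_iff.2 h1
    have e1 : ∀ i, ∑ a, ((h i).count a : ℚ) * (∑ j, ((h j).count a : ℚ) * z j) +
        (if i = k0 then z k0 else 0) = 0 := by
      intro i
      have := congrFun hz' i
      rw [Pi.zero_apply] at this
      refine Eq.trans ?_ this
      simp only [Matrix.mulVec, dotProduct, RingHom.mapMatrix_apply, Matrix.map_apply, W,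
        Matrix.of_apply, map_add, map_sum, map_mul, hφ, map_natCast, add_mul,
        Finset.sum_add_distrib]
      congr 1
      · simp only [Finset.sum_mul, Finset.mul_sum]
        rw [Finset.sum_comm]
        exact Finset.sum_congr rfl fun a _ => Finset.sum_congr rfl fun j _ => by ring
      · by_cases hi : i = k0 <;> simp [hi, apply_ite φ]
    have e2 : ∑ a, (∑ j, ((h j).count a : ℚ) * z j) ^ 2 + z k0 ^ 2 = 0 := by
      have : ∑ i, z i * (∑ a, ((h i).count a : ℚ) * (∑ j, ((h j).count a : ℚ) * z j) +
        (if i = k0 then z k0 else 0)) = 0 := Finset.sum_eq_zero fun i _ => by rw [e1, mul_zero]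
      rw [← this]
      simp only [mul_add, Finset.sum_add_distrib]
      congr 1
      · simp only [Finset.mul_sum (s := (Finset.univ : Finset (Fin c)))]
        rw [Finset.sum_comm]
        refine Finset.sum_congr rfl fun a _ => ?_
        rw [sq, Finset.sum_mul]
        exact Finset.sum_congr rfl fun i _ => by ring
      · simp [sq]
    have p1 : 0 ≤ ∑ a, (∑ j, ((h j).count a : ℚ) * z j) ^ 2 :=
      Finset.sum_nonneg fun a _ => sq_nonneg _
    have p2 : z k0 = 0 := by
      have : z k0 ^ 2 = 0 := by nlinarith [sq_nonneg (z k0)]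
      exact pow_eq_zero_iff (two_ne_zero) |>.1 this
    have p3 : ∑ a, (∑ j, ((h j).count a : ℚ) * z j) ^ 2 = 0 := by
      rw [p2] at e2; simpa using e2
    have p4 : Ker h z := by
      intro a
      have := (Finset.sum_eq_zero_iff_of_nonneg (fun a _ => sq_nonneg _)).1 p3 a (Finset.mem_univ a)
      exact pow_eq_zero_iff (two_ne_zero) |>.1 this
    obtain ⟨t, rfl⟩ := hl2 z p4
    have : t = 0 := by
      rcases mul_eq_zero.1 p2 with h | h
      · exact h
      · exact absurd h hk0
    exact hz (by rw [this, zero_smul])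
  have hpar : ∀ l, α l * β k0 = α k0 * β l := by
    have : W.mulVec (fun l => α l * β k0 - α k0 * β l) = 0 := by
      funext i
      rw [hW]
      have : ∀ a, ∑ j, (α j * β k0 - α k0 * β j) * fox (h j) a = 0 := by
        intro a
        have : ∑ j, (α j * β k0 - α k0 * β j) * fox (h j) a =
          β k0 * ∑ j, α j * fox (h j) a - α k0 * ∑ j, β j * fox (h j) a := by
          rw [Finset.mul_sum, Finset.mul_sum, ← Finset.sum_sub_distrib]
          exact Finset.sum_congr rfl fun j _ => by ring
        rw [this, hα, hβ]; ring
      simp [this]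
    intro l
    exact sub_eq_zero.1 (congrFun (Matrix.eq_zero_of_mulVec_eq_zero hdet this) l)
  by_cases h0 : α k0 = 0
  · have : W.mulVec α = 0 := by
      funext i
      rw [hW]; simp [hα, h0]
    have := Matrix.eq_zero_of_mulVec_eq_zero hdet this
    simp [this]
  · apply mul_left_cancel₀ h0
    linear_combination (-α k) * hpar l + α l * hpar k

/-- Image of an exponent vector. -/
noncomputable def expo {n c : ℕ} (h : Fin n → List (Fin c)) (γ : Fin n →₀ ℕ) : Fin c →₀ ℕ :=
  ∑ j, γ j • Multiset.toFinsupp (h j : Multiset (Fin c))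

lemma mono_eq {n : ℕ} (w : List (Fin n)) :
    mono w = MvPolynomial.monomial (Multiset.toFinsupp (w : Multiset (Fin n))) 1 := by
  induction w with
  | nil => simp [mono]
  | cons a w ih =>
    rw [mono_cons, ih, ← Multiset.cons_coe, ← Multiset.singleton_add, map_add,
      Multiset.toFinsupp_singleton, MvPolynomial.X, MvPolynomial.monomial_mul, mul_one]

lemma star_monomial {n c : ℕ} (h : Fin n → List (Fin c)) (γ : Fin n →₀ ℕ) (r : ℤ) :
    star' h (MvPolynomial.monomial γ r) = MvPolynomial.monomial (expo h γ) r := by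
  rw [star', MvPolynomial.aeval_monomial, Finsupp.prod_fintype _ _ (by simp)]
  simp only [mono_eq, MvPolynomial.monomial_pow, one_pow]
  rw [← MvPolynomial.monomial_sum_one, ← expo]
  rw [MvPolynomial.algebraMap_eq, MvPolynomial.C_mul_monomial, mul_one]

lemma coeff_star {n c : ℕ} (h : Fin n → List (Fin c)) (p : MvPolynomial (Fin n) ℤ)
    (δ : Fin c →₀ ℕ) : (star' h p).coeff δ =
      ∑ γ ∈ p.support, if expo h γ = δ then p.coeff γ else 0 := by
  conv_lhs => rw [p.as_sum, map_sum, MvPolynomial.coeff_sum]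
  simp only [star_monomial, MvPolynomial.coeff_monomial]

lemma expo_eq_iff {n c : ℕ} (h : Fin n → List (Fin c)) (γ γ' : Fin n →₀ ℕ) :
    expo h γ = expo h γ' ↔ Ker h (fun j => (γ j : ℚ) - γ' j) := by
  rw [Finsupp.ext_iff]
  refine forall_congr' fun a => ?_
  simp only [expo, Finsupp.coe_finsetSum, Finset.sum_apply, Finsupp.smul_apply,
    Multiset.toFinsupp_apply, Multiset.coe_count, smul_eq_mul, mul_sub, Finset.sum_sub_distrib,
    sub_eq_zero]
  rw [← Nat.cast_inj (R := ℚ)]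
  push_cast
  simp only [mul_comm]

lemma exists_other {n c : ℕ} (h : Fin n → List (Fin c)) (p : MvPolynomial (Fin n) ℤ)
    (hp : star' h p = 0) (γ : Fin n →₀ ℕ) (hγ : γ ∈ p.support) :
    ∃ γ' ∈ p.support, γ' ≠ γ ∧ expo h γ' = expo h γ := by
  by_contra hcon
  push Not at hcon
  have h1 := coeff_star h p (expo h γ)
  rw [hp, MvPolynomial.coeff_zero, Finset.sum_eq_single γ] at h1
  · simp at h1
    exact (MvPolynomial.mem_support_iff.1 hγ) h1.symm
  · intro b hb hne
    rw [if_neg (hcon b hb hne)]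
  · intro hh; exact absurd hγ hh

lemma star_transfer {n c c' : ℕ} (h : Fin n → List (Fin c)) (h' : Fin n → List (Fin c'))
    (hk : ∀ z, Ker h z ↔ Ker h' z) (p : MvPolynomial (Fin n) ℤ)
    (hp : star' h p = 0) : star' h' p = 0 := by
  have hk' : ∀ γ γ', expo h γ = expo h γ' ↔ expo h' γ = expo h' γ' := fun γ γ' => by
    rw [expo_eq_iff, expo_eq_iff, hk]
  ext δ
  rw [MvPolynomial.coeff_zero, coeff_star]
  by_cases hδ : ∃ γ, expo h' γ = δ
  · obtain ⟨γ, rfl⟩ := hδ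
    have := coeff_star h p (expo h γ)
    rw [hp, MvPolynomial.coeff_zero] at this
    refine Eq.trans ?_ this.symm
    refine Finset.sum_congr rfl fun γ' _ => ?_
    simp only [hk']
  · refine Finset.sum_eq_zero fun γ _ => if_neg fun hh => hδ ⟨γ, hh⟩

lemma transfer_sol {n c' : ℕ} {h' : Fin n → List (Fin c')}
    {E F : List (Fin n) × List (Fin n)}
    (hmin : ∀ k l, star' h' (vec E k * vec F l - vec E l * vec F k) = 0)
    (hne : ∃ k, star' h' (vec E k) ≠ 0) (hE' : IsSolutionE h' E) : IsSolutionE h' F := by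
  obtain ⟨k, hk⟩ := hne
  rw [sol_iff] at *
  intro a
  apply mul_left_cancel₀ hk
  have : star' h' (vec E k) * ∑ j, star' h' (vec F j) * fox (h' j) a =
      star' h' (vec F k) * ∑ j, star' h' (vec E j) * fox (h' j) a := by
    rw [Finset.mul_sum, Finset.mul_sum]
    refine Finset.sum_congr rfl fun j _ => ?_
    have := hmin k j
    rw [map_sub, map_mul, map_mul] at this
    linear_combination fox (h' j) a * this
  rw [this, hE' a]; ring

lemma minors_vanish {n c : ℕ} {h : Fin n → List (Fin c)} {lam : Fin n → ℚ} (hl : Line h lam)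
    {E F : List (Fin n) × List (Fin n)} (hE : IsSolutionE h E) (hF : IsSolutionE h F)
    (k l : Fin n) : star' h (vec E k * vec F l - vec E l * vec F k) = 0 := by
  rw [sol_iff] at hE hF
  rw [map_sub, map_mul, map_mul, sub_eq_zero]
  exact parallel hl hE hF k l

lemma constCoeff_mono {n : ℕ} (w : List (Fin n)) (hw : w ≠ []) :
    MvPolynomial.constantCoeff (mono w) = 0 := by
  cases w with
  | nil => exact absurd rfl hw
  | cons a w => simp [mono_cons]

lemma constCoeff_mono_nonneg {n : ℕ} (w : List (Fin n)) :
    0 ≤ MvPolynomial.constantCoeff (mono w) := by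
  cases w with
  | nil => simp [mono]
  | cons a w => simp [mono_cons]

lemma constCoeff_fox_nonneg {n c : ℕ} (h : Fin n → List (Fin c)) (w : List (Fin n)) (k : Fin n) :
    0 ≤ MvPolynomial.constantCoeff (star' h (fox w k)) := by
  induction w with
  | nil => simp [fox]
  | cons a w ih =>
    simp only [fox, map_add, map_mul, star_X]
    have : 0 ≤ MvPolynomial.constantCoeff (star' h (if a = k then 1 else 0)) := by
      split_ifs <;> simp
    have := mul_nonneg (constCoeff_mono_nonneg (h a)) ih
    linarith

lemma first_aux {n c : ℕ} (h : Fin n → List (Fin c)) (a b : Fin n) (hab : a ≠ b)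
    (u v : List (Fin n)) (h0 : star' h (fox (a :: u) a - fox (b :: v) a) = 0) : h b = [] := by
  by_contra hb
  have h1 := congrArg MvPolynomial.constantCoeff h0
  simp only [fox, map_add, map_mul, map_sub, star_X, constCoeff_mono _ hb, if_neg hab.symm] at h1
  have := mul_nonneg (constCoeff_mono_nonneg (h a)) (constCoeff_fox_nonneg h u a)
  simp at h1
  linarith

lemma first_letters {n : ℕ} (u v : List (Fin n)) (huv : u ≠ v) :
    ∃ a b : Fin n, ∀ (c : ℕ) (h : Fin n → List (Fin c)),
      (star' h (fox u a - fox v a) = 0 → a ≠ b ∧ h b = []) ∧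
      (star' h (fox u b - fox v b) = 0 → a ≠ b ∧ h a = []) := by
  have nz : ∀ (b : Fin n) (v : List (Fin n)) (c : ℕ) (h : Fin n → List (Fin c)),
      star' h (fox (b :: v) b) ≠ 0 := by
    intro b v c h h0
    have h1 := congrArg MvPolynomial.constantCoeff h0
    simp only [fox, map_add, map_mul, star_X] at h1
    have := mul_nonneg (constCoeff_mono_nonneg (h b)) (constCoeff_fox_nonneg h v b)
    simp at h1
    linarith
  induction u generalizing v with
  | nil =>
    cases v with
    | nil => exact absurd rfl huv
    | cons b v =>
      refine ⟨b, b, fun c h => ?_⟩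
      have := nz b v c h
      simp only [fox.eq_1, zero_sub, map_neg, neg_eq_zero]
      exact ⟨fun h => absurd h this, fun h => absurd h this⟩
  | cons a u ih =>
    cases v with
    | nil =>
      refine ⟨a, a, fun c h => ?_⟩
      have := nz a u c h
      simp only [fox.eq_1, sub_zero]
      exact ⟨fun h => absurd h this, fun h => absurd h this⟩
    | cons b v =>
      by_cases hab : a = b
      · subst hab
        obtain ⟨x, y, hxy⟩ := ih v (fun hh => huv (by rw [hh]))
        have key : ∀ (k : Fin n) (c : ℕ) (h : Fin n → List (Fin c)),
            star' h (fox (a :: u) k - fox (a :: v) k) = 0 → star' h (fox u k - fox v k) = 0 := by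
          intro k c h h0
          have : fox (a :: u) k - fox (a :: v) k = MvPolynomial.X a * (fox u k - fox v k) := by
            simp only [fox]; ring
          rw [this, map_mul, star_X] at h0
          exact (mul_eq_zero.1 h0).resolve_left (mono_ne_zero _)
        exact ⟨x, y, fun c h => ⟨fun h0 => (hxy c h).1 (key x c h h0),
          fun h0 => (hxy c h).2 (key y c h h0)⟩⟩
      · refine ⟨a, b, fun c h => ⟨fun h0 => ⟨hab, first_aux h a b hab u v h0⟩, fun h0 => ⟨hab, ?_⟩⟩⟩
        refine first_aux h b a (Ne.symm hab) v u ?_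
        rw [← neg_sub, map_neg, h0, neg_zero]

lemma no_two_erased {n c : ℕ} {h : Fin n → List (Fin c)} {lam : Fin n → ℚ} (hl : Line h lam)
    {a b : Fin n} (hab : a ≠ b) (ha : h a = []) (hb : h b = []) : False := by
  have key : ∀ x, h x = [] → Ker h (Pi.single x 1) := by
    intro x hx d
    refine Finset.sum_eq_zero fun j _ => ?_
    by_cases hj : j = x
    · subst hj; simp [hx]
    · simp [hj]
  obtain ⟨s, hs⟩ := hl.2.2 _ (key a ha)
  obtain ⟨t, ht⟩ := hl.2.2 _ (key b hb)
  have e1 := congrFun hs a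
  have e2 := congrFun hs b
  have e3 := congrFun ht b
  have e4 := congrFun ht a
  simp [hab, Ne.symm hab] at e1 e2 e3 e4
  rcases e2 with h | h
  · simp [h] at e1
  · simp [h] at e3

lemma vec_ne_zero {n c : ℕ} {h : Fin n → List (Fin c)} {lam : Fin n → ℚ} (hl : Line h lam)
    {E : List (Fin n) × List (Fin n)} (hE : E.1 ≠ E.2) : ∃ k, star' h (vec E k) ≠ 0 := by
  by_contra hcon
  push Not at hcon
  obtain ⟨a, b, hab⟩ := first_letters E.1 E.2 hE
  obtain ⟨h1, h2⟩ := (hab c h).1 (hcon a)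
  exact no_two_erased hl h1 ((hab c h).2 (hcon b)).2 h2

lemma erased_letters {n : ℕ} {E : List (Fin n) × List (Fin n)} (hE : E.1 ≠ E.2) :
    ∃ a b : Fin n, ∀ (c : ℕ) (h : Fin n → List (Fin c)) (lam : Fin n → ℚ), Line h lam →
      IsSolutionE h E → ∀ x, h x = [] → x = a ∨ x = b := by
  obtain ⟨a, b, hab⟩ := first_letters E.1 E.2 hE
  refine ⟨a, b, fun c h lam hl hs x hx => ?_⟩
  by_contra hcon
  push Not at hcon
  have hz : star' h (vec E a) = 0 := by
    rw [sol_iff] at hs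
    have hx' : ∀ d, ∑ j, (if j = x then (1 : MvPolynomial (Fin c) ℤ) else 0) * fox (h j) d = 0 := by
      intro d
      simp [hx, fox]
    have := parallel hl hs hx' a x
    simpa [Ne.symm hcon.1] using this
  obtain ⟨-, h1⟩ := (hab c h).1 hz
  exact no_two_erased hl hcon.2 hx h1

/-- Two lines: same kernel if one contains the other's generator. -/
lemma ker_eq {n c c' : ℕ} {h : Fin n → List (Fin c)} {h' : Fin n → List (Fin c')}
    {lam lam' : Fin n → ℚ} (hl : Line h lam) (hl' : Line h' lam') (hk : Ker h lam') :
    ∀ z, Ker h z ↔ Ker h' z := by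
  have smulK : ∀ {c : ℕ} (g : Fin n → List (Fin c)) (t : ℚ) (z : Fin n → ℚ), Ker g z →
      Ker g (t • z) := by
    intro c g t z hz a
    have := hz a
    have e : ∑ j, ((g j).count a : ℚ) * (t • z) j = t * ∑ j, ((g j).count a : ℚ) * z j := by
      rw [Finset.mul_sum]
      exact Finset.sum_congr rfl fun j _ => by simp; ring
    rw [e, this, mul_zero]
  obtain ⟨s, hs⟩ := hl.2.2 _ hk
  have hs0 : s ≠ 0 := by
    rintro rfl
    exact hl'.1 (by simpa using hs)
  intro z
  constructor
  · intro hz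
    obtain ⟨t, rfl⟩ := hl.2.2 z hz
    have : lam = s⁻¹ • lam' := by rw [hs, smul_smul, inv_mul_cancel₀ hs0, one_smul]
    rw [this]
    exact smulK _ _ _ (smulK _ _ _ hl'.2.1)
  · intro hz
    obtain ⟨t, rfl⟩ := hl'.2.2 z hz
    exact smulK _ _ _ hk

/-- If two solutions of `E` have the same kernel, they solve the same equations. -/
lemma same_ker {n c c' : ℕ} {h : Fin n → List (Fin c)} {h' : Fin n → List (Fin c')}
    {lam lam' : Fin n → ℚ} (hl : Line h lam) (hl' : Line h' lam')
    (hk : ∀ z, Ker h z ↔ Ker h' z)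
    {E F : List (Fin n) × List (Fin n)} (hE : E.1 ≠ E.2) (h1 : IsSolutionE h E)
    (h2 : IsSolutionE h' E) (h3 : IsSolutionE h F) : IsSolutionE h' F :=
  transfer_sol (fun k l => star_transfer h h' hk _ (minors_vanish hl h1 h3 k l))
    (vec_ne_zero hl' hE) h2

/-- The list of exponents of prefixes preceding an occurrence of `k`. -/
noncomputable def pre {n : ℕ} : List (Fin n) → Fin n → List (Fin n →₀ ℕ)
  | [], _ => []
  | c :: w, k => (if c = k then [0] else []) ++ (pre w k).map (fun γ => Finsupp.single c 1 + γ)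

lemma length_pre {n : ℕ} (w : List (Fin n)) (k : Fin n) : (pre w k).length = w.count k := by
  induction w with
  | nil => simp [pre]
  | cons c w ih =>
    by_cases hc : c = k
    · simp [pre, ih, hc]
    · simp [pre, ih, hc]

lemma support_fox {n : ℕ} (w : List (Fin n)) (k : Fin n) :
    ∀ γ ∈ (fox w k).support, γ ∈ pre w k := by
  induction w with
  | nil => simp [fox]
  | cons c w ih =>
    intro γ hγ
    simp only [fox] at hγ
    have h1 := MvPolynomial.support_add hγ
    rw [Finset.mem_union] at h1
    simp only [pre, List.mem_append]
    rcases h1 with h1 | h1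
    · left
      by_cases hc : c = k
      · simp only [hc, if_true] at h1 ⊢
        rw [MvPolynomial.mem_support_iff, MvPolynomial.coeff_one] at h1
        by_cases h0 : 0 = γ
        · simp [h0]
        · simp [h0] at h1
      · simp [hc] at h1
    · right
      rw [MvPolynomial.support_X_mul, Finset.mem_map] at h1
      obtain ⟨δ, hδ, rfl⟩ := h1
      exact List.mem_map.2 ⟨δ, ih δ hδ, rfl⟩

lemma pre_chain {n : ℕ} (w : List (Fin n)) (k : Fin n) :
    ∀ x ∈ pre w k, ∀ y ∈ pre w k, x ≤ y ∨ y ≤ x := by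
  induction w with
  | nil => simp [pre]
  | cons c w ih =>
    have key : ∀ x ∈ pre (c :: w) k, x = 0 ∨ ∃ δ ∈ pre w k, x = Finsupp.single c 1 + δ := by
      intro x hx
      simp only [pre, List.mem_append, List.mem_map] at hx
      rcases hx with hx | ⟨δ, hδ, rfl⟩
      · left; split_ifs at hx <;> simp_all
      · exact Or.inr ⟨δ, hδ, rfl⟩
    intro x hx y hy
    rcases key x hx with rfl | ⟨δ, hδ, rfl⟩
    · left; exact zero_le
    rcases key y hy with rfl | ⟨δ', hδ', rfl⟩
    · right; exact zero_le
    rcases ih δ hδ δ' hδ' with h | h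
    · left; gcongr
    · right; gcongr

lemma antichain_bound {n : ℕ} (E F : List (Fin n) × List (Fin n)) (k l : Fin n)
    (M : Finset (Fin n →₀ ℕ))
    (hM : ∀ γ ∈ M, γ ∈ (vec E k * vec F l - vec E l * vec F k).support)
    (hanti : ∀ x ∈ M, ∀ y ∈ M, x ≤ y → x = y) :
    M.card ≤ 2 * ((E.1.count k + E.2.count k) + (E.1.count l + E.2.count l)) := by
  classical
  have mem_vec : ∀ (E : List (Fin n) × List (Fin n)) (k : Fin n), ∀ γ ∈ (vec E k).support,
      γ ∈ pre E.1 k ∨ γ ∈ pre E.2 k := by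
    intro E k γ hγ
    have := MvPolynomial.support_sub _ _ _ hγ
    rw [Finset.mem_union] at this
    exact this.imp (support_fox _ _ γ) (support_fox _ _ γ)
  let P : Fin n → List (Fin n →₀ ℕ) := fun k => pre E.1 k ++ pre E.2 k
  let Q : Bool → Fin n → List (Fin n →₀ ℕ) := fun s k => if s then pre F.1 k else pre F.2 k
  have hQ : ∀ s k, ∀ x ∈ Q s k, ∀ y ∈ Q s k, x ≤ y ∨ y ≤ x := by
    intro s k
    cases s
    · exact pre_chain F.2 k
    · exact pre_chain F.1 k
  let I := (Fin (P k).length ⊕ Fin (P l).length) × Bool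
  let C : I → Set (Fin n →₀ ℕ) := fun i => match i.1 with
    | Sum.inl a => {γ | ∃ y ∈ Q i.2 l, γ = (P k).get a + y}
    | Sum.inr a => {γ | ∃ y ∈ Q i.2 k, γ = (P l).get a + y}
  have hC : ∀ i, ∀ x ∈ C i, ∀ y ∈ C i, x ≤ y ∨ y ≤ x := by
    rintro ⟨a | a, s⟩ x ⟨x', hx', rfl⟩ y ⟨y', hy', rfl⟩
    · rcases hQ _ _ x' hx' y' hy' with h | h
      · left; gcongr
      · right; gcongr
    · rcases hQ _ _ x' hx' y' hy' with h | h
      · left; gcongr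
      · right; gcongr
  have hmul : ∀ k l, ∀ γ ∈ (vec E k * vec F l).support, ∃ a : Fin (P k).length, ∃ s, ∃ y ∈ Q s l,
      γ = (P k).get a + y := by
    intro k l γ hγ
    obtain ⟨x, hx, y, hy, rfl⟩ := Finset.mem_add.1 (MvPolynomial.support_mul _ _ hγ)
    have hx' : x ∈ P k := List.mem_append.2 (mem_vec E k x hx)
    obtain ⟨a, rfl⟩ := List.get_of_mem hx'
    rcases mem_vec F l y hy with h | h
    · exact ⟨a, true, y, h, rfl⟩
    · exact ⟨a, false, y, h, rfl⟩
  have hcov : ∀ γ ∈ M, ∃ i, γ ∈ C i := by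
    intro γ hγ
    have := MvPolynomial.support_sub _ _ _ (hM γ hγ)
    rw [Finset.mem_union] at this
    rcases this with h | h
    · obtain ⟨a, s, y, hy, e⟩ := hmul k l γ h
      exact ⟨(Sum.inl a, s), y, hy, e⟩
    · obtain ⟨a, s, y, hy, e⟩ := hmul l k γ h
      exact ⟨(Sum.inr a, s), y, hy, e⟩
  have hcard : Fintype.card I =
      2 * ((E.1.count k + E.2.count k) + (E.1.count l + E.2.count l)) := by
    simp only [I, Fintype.card_prod, Fintype.card_sum, Fintype.card_fin, Fintype.card_bool, P,
      List.length_append, length_pre]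
    ring
  rw [← hcard, ← Fintype.card_coe]
  choose f hf using hcov
  refine Fintype.card_le_of_injective (fun γ : M => f γ.1 γ.2) ?_
  intro x y hxy
  have hx := hf x.1 x.2
  have hy := hf y.1 y.2
  simp only at hxy
  rw [hxy] at hx
  apply Subtype.ext
  rcases hC _ _ hx _ hy with h | h
  · exact hanti _ x.2 _ y.2 h
  · exact (hanti _ y.2 _ x.2 h).symm

open Filter Topology in
lemma perturb {n : ℕ} {ι : Type} [Fintype ι] (lam : ι → Fin n → ℚ) (j : ι) (w0 : Fin n → ℚ)
    (hpos : ∀ x, 0 < w0 x) (hne : ∀ i, i ≠ j → w0 ⬝ᵥ lam i ≠ 0) :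
    ∃ ε : ℚ, 0 < ε ∧ (∀ x, 0 < w0 x + ε * lam j x) ∧ (∀ x, 0 < w0 x - ε * lam j x) ∧
      ∀ i, i ≠ j → (w0 ⬝ᵥ lam i + ε * (lam j ⬝ᵥ lam i)) * (w0 ⬝ᵥ lam i) > 0 ∧
        (w0 ⬝ᵥ lam i - ε * (lam j ⬝ᵥ lam i)) * (w0 ⬝ᵥ lam i) > 0 := by
  have key : ∀ f : ℚ → ℚ, Continuous f → 0 < f 0 → ∀ᶠ ε in 𝓝[>] (0 : ℚ), 0 < f ε := by
    intro f hf h0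
    exact (hf.continuousAt.eventually (lt_mem_nhds h0)).filter_mono nhdsWithin_le_nhds
  have h1 : ∀ᶠ ε in 𝓝[>] (0 : ℚ), ∀ x, 0 < w0 x + ε * lam j x :=
    eventually_all.2 fun x => key (fun ε => w0 x + ε * lam j x) (by fun_prop) (by simpa using hpos x)
  have h2 : ∀ᶠ ε in 𝓝[>] (0 : ℚ), ∀ x, 0 < w0 x - ε * lam j x :=
    eventually_all.2 fun x => key (fun ε => w0 x - ε * lam j x) (by fun_prop) (by simpa using hpos x)
  have h3 : ∀ᶠ ε in 𝓝[>] (0 : ℚ), ∀ i, i ≠ j →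
      0 < (w0 ⬝ᵥ lam i + ε * (lam j ⬝ᵥ lam i)) * (w0 ⬝ᵥ lam i) := by
    refine eventually_all.2 fun i => ?_
    by_cases hi : i = j
    · simp [hi]
    · filter_upwards [key (fun ε => (w0 ⬝ᵥ lam i + ε * (lam j ⬝ᵥ lam i)) * (w0 ⬝ᵥ lam i))
        (by fun_prop) (by simpa using hne i hi)] with ε hε _ using hε
  have h4 : ∀ᶠ ε in 𝓝[>] (0 : ℚ), ∀ i, i ≠ j →
      0 < (w0 ⬝ᵥ lam i - ε * (lam j ⬝ᵥ lam i)) * (w0 ⬝ᵥ lam i) := by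
    refine eventually_all.2 fun i => ?_
    by_cases hi : i = j
    · simp [hi]
    · filter_upwards [key (fun ε => (w0 ⬝ᵥ lam i - ε * (lam j ⬝ᵥ lam i)) * (w0 ⬝ᵥ lam i))
        (by fun_prop) (by simpa using hne i hi)] with ε hε _ using hε
  obtain ⟨ε, ⟨⟨⟨a, b⟩, c⟩, d⟩, e⟩ :=
    ((((h1.and h2).and h3).and h4).and (self_mem_nhdsWithin)).exists
  exact ⟨ε, e, a, b, fun i hi => ⟨c i hi, d i hi⟩⟩

/-- Positive weights avoiding all hyperplanes. -/
def Wts {n : ℕ} {ι : Type} (lam : ι → Fin n → ℚ) : Set (Fin n → ℚ) :=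
  {w | (∀ x, 0 < w x) ∧ ∀ i, w ⬝ᵥ lam i ≠ 0}

lemma sides {n : ℕ} {ι : Type} [Fintype ι] (lam : ι → Fin n → ℚ) (j : ι) (hj : lam j ≠ 0)
    (w0 : Fin n → ℚ)
    (hpos : ∀ x, 0 < w0 x) (h0 : w0 ⬝ᵥ lam j = 0) (hne : ∀ i, i ≠ j → w0 ⬝ᵥ lam i ≠ 0) :
    ∃ w ∈ Wts lam, ∃ w' ∈ Wts lam, 0 < w ⬝ᵥ lam j ∧ w' ⬝ᵥ lam j < 0 ∧
      ∀ i, i ≠ j → (0 < w ⬝ᵥ lam i ↔ 0 < w' ⬝ᵥ lam i) := by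
  obtain ⟨ε, he, h1, h2, h3⟩ := perturb lam j w0 hpos hne
  have e1 : ∀ i, (w0 + ε • lam j) ⬝ᵥ lam i = w0 ⬝ᵥ lam i + ε * (lam j ⬝ᵥ lam i) := by
    intro i; simp [add_dotProduct, smul_dotProduct]
  have e2 : ∀ i, (w0 - ε • lam j) ⬝ᵥ lam i = w0 ⬝ᵥ lam i - ε * (lam j ⬝ᵥ lam i) := by
    intro i; simp [sub_dotProduct, smul_dotProduct]
  have hsq : 0 < lam j ⬝ᵥ lam j := by
    have h1 : 0 ≤ lam j ⬝ᵥ lam j := Finset.sum_nonneg fun x _ => mul_self_nonneg _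
    have h2 : lam j ⬝ᵥ lam j ≠ 0 := fun h => hj (dotProduct_self_eq_zero.1 h)
    exact lt_of_le_of_ne h1 (Ne.symm h2)
  have p1 : 0 < (w0 + ε • lam j) ⬝ᵥ lam j := by rw [e1, h0]; simpa using mul_pos he hsq
  have p2 : (w0 - ε • lam j) ⬝ᵥ lam j < 0 := by rw [e2, h0]; simpa using mul_pos he hsq
  refine ⟨w0 + ε • lam j, ⟨fun x => by simpa using h1 x, fun i => ?_⟩,
    w0 - ε • lam j, ⟨fun x => by simpa using h2 x, fun i => ?_⟩, p1, p2, fun i hi => ?_⟩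
  · by_cases hi : i = j
    · rw [hi]; exact p1.ne'
    · rw [e1]; exact left_ne_zero_of_mul (h3 i hi).1.ne'
  · by_cases hi : i = j
    · rw [hi]; exact p2.ne
    · rw [e2]; exact left_ne_zero_of_mul (h3 i hi).2.ne'
  · rw [e1, e2]
    obtain ⟨q1, q2⟩ := h3 i hi
    rcases lt_or_gt_of_ne (hne i hi) with h | h
    · have r1 := neg_of_mul_pos_left q1 h.le
      have r2 := neg_of_mul_pos_left q2 h.le
      constructor <;> intro <;> linarith
    · have r1 := pos_of_mul_pos_left q1 h.le
      have r2 := pos_of_mul_pos_left q2 h.le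
      exact ⟨fun _ => r2, fun _ => r1⟩

open Classical in
/-- Sign pattern of a weight. -/
noncomputable def pat {n : ℕ} {ι : Type} (lam : ι → Fin n → ℚ) (J : Finset ι)
    (w : Fin n → ℚ) : Finset ι := J.filter (fun i => 0 < w ⬝ᵥ lam i)

lemma patterns {n : ℕ} {ι : Type} [Fintype ι] (lam : ι → Fin n → ℚ) (h0 : ∀ j, lam j ≠ 0)
    (hw : ∀ j, ∃ w0 : Fin n → ℚ, (∀ x, 0 < w0 x) ∧ w0 ⬝ᵥ lam j = 0 ∧
      ∀ i, i ≠ j → w0 ⬝ᵥ lam i ≠ 0) (J : Finset ι) :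
    J.card + 1 ≤ (pat lam J '' Wts lam).ncard := by
  classical
  have fin : ∀ J, (pat lam J '' Wts lam).Finite := fun J => Set.toFinite _
  have hne : (Wts lam).Nonempty := by
    rcases isEmpty_or_nonempty ι with h | ⟨⟨j⟩⟩
    · exact ⟨fun _ => 1, fun _ => one_pos, fun i => (IsEmpty.false i).elim⟩
    · obtain ⟨w0, a, b, c⟩ := hw j
      obtain ⟨w, hw, -⟩ := sides lam j (h0 j) w0 a b c
      exact ⟨w, hw⟩
  induction J using Finset.induction_on with
  | empty =>
    rw [Finset.card_empty, zero_add, Nat.succ_le_iff, Set.ncard_pos (fin _)]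
    exact hne.image _
  | insert j J hj ih =>
    obtain ⟨w0, a, b, c⟩ := hw j
    obtain ⟨w, hw, w', hw', p1, p2, p3⟩ := sides lam j (h0 j) w0 a b c
    have him : pat lam J '' Wts lam =
        (fun s : Finset ι => s.erase j) '' (pat lam (insert j J) '' Wts lam) := by
      rw [Set.image_image]
      refine Set.image_congr fun w _ => ?_
      ext i
      simp only [pat, Finset.mem_filter, Finset.mem_erase, Finset.mem_insert]
      constructor
      · rintro ⟨h1, h2⟩
        exact ⟨fun h => hj (h ▸ h1), Or.inr h1, h2⟩
      · rintro ⟨h1, h2, h3⟩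
        exact ⟨h2.resolve_left h1, h3⟩
    have hlt : (pat lam J '' Wts lam).ncard < (pat lam (insert j J) '' Wts lam).ncard := by
      rw [him]
      refine lt_of_le_of_ne (Set.ncard_image_le (fin _)) fun heq => ?_
      have hinj := (Set.ncard_image_iff (fin _)).1 heq
      have := hinj (Set.mem_image_of_mem _ hw) (Set.mem_image_of_mem _ hw') (by
        ext i
        simp only [pat, Finset.mem_filter, Finset.mem_erase]
        constructor
        · rintro ⟨h1, h2, h3⟩; exact ⟨h1, h2, (p3 i h1).1 h3⟩
        · rintro ⟨h1, h2, h3⟩; exact ⟨h1, h2, (p3 i h1).2 h3⟩)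
      have hmem : j ∈ pat lam (insert j J) w := by simp [pat, p1]
      rw [this] at hmem
      simp [pat] at hmem
      linarith
    rw [Finset.card_insert_of_notMem hj]
    omega

lemma exists_weight {n c : ℕ} (h : Fin n → List (Fin c)) (hne : ∀ x, h x ≠ [])
    (S : Finset (Fin n → ℚ)) (hS : ∀ z ∈ S, ¬ Ker h z) :
    ∃ w : Fin n → ℚ, (∀ x, 0 < w x) ∧ (∀ z, Ker h z → w ⬝ᵥ z = 0) ∧ ∀ z ∈ S, w ⬝ᵥ z ≠ 0 := by
  classical
  let q : (Fin n → ℚ) → Polynomial ℚ := fun z =>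
    ∑ a : Fin c, Polynomial.monomial (a : ℕ) (∑ j, ((h j).count a : ℚ) * z j)
  have hq : ∀ z ∈ S, q z ≠ 0 := by
    intro z hz h0
    apply hS z hz
    intro a
    have := congrArg (fun p => Polynomial.coeff p (a : ℕ)) h0
    simp only [q, Polynomial.finsetSum_coeff, Polynomial.coeff_monomial, Polynomial.coeff_zero] at this
    rw [Finset.sum_eq_single a] at this
    · simpa using this
    · intro b _ hb; rw [if_neg]; exact fun h => hb (Fin.ext h)
    · simp
  have hprod : ∏ z ∈ S, q z ≠ 0 := Finset.prod_ne_zero_iff.2 hq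
  obtain ⟨t, ht, ht'⟩ : ∃ t : ℚ, 0 < t ∧ (∏ z ∈ S, q z).eval t ≠ 0 := by
    by_contra hcon
    push Not at hcon
    exact hprod (Polynomial.eq_zero_of_infinite_isRoot _
      ((Set.Ioi_infinite (0 : ℚ)).mono fun t ht => hcon t ht))
  rw [Polynomial.eval_prod, Finset.prod_ne_zero_iff] at ht'
  let w : Fin n → ℚ := fun j => ∑ a : Fin c, ((h j).count a : ℚ) * t ^ (a : ℕ)
  have hw : ∀ z, w ⬝ᵥ z = ∑ a : Fin c, (∑ j, ((h j).count a : ℚ) * z j) * t ^ (a : ℕ) := by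
    intro z
    simp only [dotProduct, w, Finset.sum_mul]
    rw [Finset.sum_comm]
    exact Finset.sum_congr rfl fun a _ => Finset.sum_congr rfl fun j _ => by ring
  refine ⟨w, fun x => ?_, fun z hz => ?_, fun z hz => ?_⟩
  · obtain ⟨a, ha⟩ := List.exists_mem_of_ne_nil _ (hne x)
    refine Finset.sum_pos' (fun b _ => by positivity) ⟨a, Finset.mem_univ a, ?_⟩
    have : 0 < (h x).count a := List.count_pos_iff.2 ha
    positivity
  · rw [hw]
    exact Finset.sum_eq_zero fun a _ => by rw [hz a, zero_mul]
  · rw [hw]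
    have := ht' z hz
    simpa only [q, Polynomial.eval_finsetSum, Polynomial.eval_monomial] using this

lemma minimal_count {n : ℕ} {ι : Type} [Fintype ι] (c : ι → ℕ)
    (g : ∀ i, Fin n → List (Fin (c i))) (lam : ι → Fin n → ℚ) (hl : ∀ i, Line (g i) (lam i))
    (hdist : ∀ i j, i ≠ j → ¬ Ker (g i) (lam j)) (hne : ∀ i x, g i x ≠ [])
    (p : MvPolynomial (Fin n) ℤ) (hp : p ≠ 0) (hv : ∀ i, star' (g i) p = 0) :
    ∃ M : Finset (Fin n →₀ ℕ), M ⊆ p.support ∧ (∀ x ∈ M, ∀ y ∈ M, x ≤ y → x = y) ∧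
      Fintype.card ι + 1 ≤ M.card := by
  classical
  have hpat := patterns lam (fun j => (hl j).1) (fun j => by
    obtain ⟨w, h1, h2, h3⟩ := exists_weight (g j) (hne j)
      ((Finset.univ.filter (fun i => i ≠ j)).image lam) (by
        intro z hz
        simp only [Finset.mem_image, Finset.mem_filter, Finset.mem_univ, true_and] at hz
        obtain ⟨i, hi, rfl⟩ := hz
        exact hdist j i (Ne.symm hi))
    refine ⟨w, h1, h2 _ (hl j).2.1, fun i hi => h3 _ ?_⟩
    simp only [Finset.mem_image, Finset.mem_filter, Finset.mem_univ, true_and]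
    exact ⟨i, hi, rfl⟩) Finset.univ
  let M := p.support.filter (fun x => ∀ y ∈ p.support, y ≤ x → y = x)
  refine ⟨M, Finset.filter_subset _ _, fun x hx y hy hxy => ?_, ?_⟩
  · exact (Finset.mem_filter.1 hy).2 x (Finset.mem_filter.1 hx).1 hxy
  let val : (Fin n → ℚ) → (Fin n →₀ ℕ) → ℚ := fun w γ => ∑ x, w x * (γ x : ℚ)
  have hmin : ∀ w, ∃ γ ∈ p.support, ∀ γ' ∈ p.support, val w γ ≤ val w γ' := fun w =>
    Finset.exists_min_image _ _ (by
      rw [Finset.nonempty_iff_ne_empty]; exact fun h => hp (MvPolynomial.support_eq_empty.1 h))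
  choose m hm1 hm2 using hmin
  have hmM : ∀ w ∈ Wts lam, m w ∈ M := by
    intro w hw
    refine Finset.mem_filter.2 ⟨hm1 w, fun y hy hle => ?_⟩
    by_contra hne
    have hlt : ∃ x, y x < m w x := by
      by_contra hcon
      push Not at hcon
      exact hne (le_antisymm hle hcon)
    obtain ⟨x, hx⟩ := hlt
    have : val w y < val w (m w) := by
      refine Finset.sum_lt_sum (fun x _ => ?_) ⟨x, Finset.mem_univ x, ?_⟩
      · exact mul_le_mul_of_nonneg_left (by exact_mod_cast hle x) (hw.1 x).le
      · exact mul_lt_mul_of_pos_left (by exact_mod_cast hx) (hw.1 x)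
    exact absurd (hm2 w y hy) (not_le.2 this)
  have hsep : ∀ w w' : Fin n → ℚ, m w = m w' → ∀ i, 0 < w ⬝ᵥ lam i → ¬ w' ⬝ᵥ lam i < 0 := by
    intro w w' hww i h1 h2
    obtain ⟨γ, hγ, hγne, hγe⟩ := exists_other (g i) p (hv i) (m w) (hm1 w)
    rw [expo_eq_iff] at hγe
    obtain ⟨t, ht⟩ := (hl i).2.2 _ hγe
    have hval : ∀ v, val v γ - val v (m w) = t * (v ⬝ᵥ lam i) := by
      intro v
      simp only [val, dotProduct, Finset.mul_sum, ← Finset.sum_sub_distrib]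
      refine Finset.sum_congr rfl fun x _ => ?_
      have := congrFun ht x
      simp only [Pi.smul_apply, smul_eq_mul] at this
      linear_combination v x * this
    have q1 := hm2 w γ hγ
    have q2 := hm2 w' γ hγ
    rw [← hww] at q2
    have r1 : 0 ≤ t * (w ⬝ᵥ lam i) := by rw [← hval]; linarith
    have r2 : 0 ≤ t * (w' ⬝ᵥ lam i) := by rw [← hval]; linarith
    have t1 : 0 ≤ t := nonneg_of_mul_nonneg_left r1 h1
    have t2 : t ≤ 0 := nonpos_of_mul_nonneg_left r2 h2
    have t0 : t = 0 := le_antisymm t2 t1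
    apply hγne
    ext x
    have := congrFun ht x
    simp only [t0, zero_smul, Pi.zero_apply, sub_eq_zero] at this
    exact_mod_cast this
  have hch : ∀ s ∈ pat lam Finset.univ '' Wts lam, ∃ w ∈ Wts lam, pat lam Finset.univ w = s :=
    fun s hs => hs
  choose! f hf1 hf2 using hch
  have hle : (pat lam Finset.univ '' Wts lam).ncard ≤ (M : Set (Fin n →₀ ℕ)).ncard := by
    refine Set.ncard_le_ncard_of_injOn (fun s => m (f s)) (fun s hs => hmM _ (hf1 s hs)) ?_
      (Finset.finite_toSet M)
    intro s hs s' hs' hss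
    simp only at hss
    rw [← hf2 s hs, ← hf2 s' hs']
    ext i
    simp only [pat, Finset.mem_filter, Finset.mem_univ, true_and]
    constructor
    · intro h
      exact lt_of_le_of_ne (not_lt.1 (hsep _ _ hss i h)) (Ne.symm ((hf1 s' hs').2 i))
    · intro h
      exact lt_of_le_of_ne (not_lt.1 (hsep _ _ hss.symm i h)) (Ne.symm ((hf1 s hs).2 i))
  rw [Set.ncard_coe_finset] at hle
  simpa using hpat.trans hle

lemma ker_erased {n : ℕ} {c c' : ℕ} {h : Fin n → List (Fin c)} {h' : Fin n → List (Fin c')}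
    {lam lam' : Fin n → ℚ} (hl : Line h lam) (hl' : Line h' lam') (x : Fin n)
    (hx : h x = []) (hx' : h' x = []) : ∀ z, Ker h z ↔ Ker h' z := by
  have key : ∀ {c : ℕ} (g : Fin n → List (Fin c)), g x = [] → Ker g (Pi.single x 1) := by
    intro c g hg d
    refine Finset.sum_eq_zero fun j _ => ?_
    by_cases hj : j = x
    · subst hj; simp [hg]
    · simp [hj]
  have hline : Line h' (Pi.single x 1) := by
    refine ⟨by simp, key h' hx', fun z hz => ?_⟩
    obtain ⟨s, hs⟩ := hl'.2.2 _ (key h' hx')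
    obtain ⟨t, ht⟩ := hl'.2.2 z hz
    have hs0 : s ≠ 0 := by
      rintro rfl
      have := congrFun hs x
      simp at this
    exact ⟨t * s⁻¹, by rw [hs, smul_smul, mul_assoc, inv_mul_cancel₀ hs0, mul_one, ht]⟩
  exact ker_eq hl hline (key h hx)

/-- A morphism into some free monoid on finitely many letters. -/
abbrev Mor (n : ℕ) : Type := Σ c : ℕ, (Fin n → List (Fin c))

lemma family_bound {n : ℕ} {ι : Type} [Fintype ι] (s : ι → Mor n) (lam : ι → Fin n → ℚ)
    (hl : ∀ i, Line (s i).2 (lam i))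
    (hdist : ∀ i j, i ≠ j → ¬ ∀ z, Ker (s i).2 z ↔ Ker (s j).2 z)
    (E F : List (Fin n) × List (Fin n)) (hE : E.1 ≠ E.2)
    (hsE : ∀ i, IsSolutionE (s i).2 E) (i0 : ι) (hsF : ∀ i, i ≠ i0 → IsSolutionE (s i).2 F)
    (her : (∃ x, (s i0).2 x = []) ∨
      ∀ i j, (∃ x, (s i).2 x = []) → (∃ x, (s j).2 x = []) → i = j)
    (k l : Fin n) (hkl : vec E k * vec F l - vec E l * vec F k ≠ 0) :
    Fintype.card ι ≤ 2 * ((E.1.count k + E.2.count k) + (E.1.count l + E.2.count l)) + 1 := by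
  classical
  have her' : ∀ i j, i ≠ i0 → j ≠ i0 → (∃ x, (s i).2 x = []) → (∃ x, (s j).2 x = []) → i = j := by
    intro i j hi hj hxi hxj
    rcases her with her | her
    · by_contra hij
      obtain ⟨a, b, hab⟩ := erased_letters hE
      obtain ⟨x, hx⟩ := her
      obtain ⟨y, hy⟩ := hxi
      obtain ⟨z, hz⟩ := hxj
      have hxy : x ≠ y := by
        rintro rfl
        exact hdist i i0 hi (ker_erased (hl i) (hl i0) x hy hx)
      have hxz : x ≠ z := by
        rintro rfl
        exact hdist j i0 hj (ker_erased (hl j) (hl i0) x hz hx)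
      have hyz : y ≠ z := by
        rintro rfl
        exact hdist i j hij (ker_erased (hl i) (hl j) y hy hz)
      have h1 := hab _ _ _ (hl i0) (hsE i0) x hx
      have h2 := hab _ _ _ (hl i) (hsE i) y hy
      have h3 := hab _ _ _ (hl j) (hsE j) z hz
      grind
    · exact her i j hxi hxj
  let A : Finset ι := Finset.univ.filter fun i => i ≠ i0 ∧ ∀ x, (s i).2 x ≠ []
  let B : Finset ι := Finset.univ.filter fun i => i ≠ i0 ∧ ∃ x, (s i).2 x = []
  have hB : B.card ≤ 1 := by
    rw [Finset.card_le_one]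
    intro i hi j hj
    simp only [B, Finset.mem_filter, Finset.mem_univ, true_and] at hi hj
    exact her' i j hi.1 hj.1 hi.2 hj.2
  have hcard : Fintype.card ι ≤ A.card + B.card + 1 := by
    have : (Finset.univ : Finset ι) ⊆ (A ∪ B) ∪ {i0} := by
      intro i _
      simp only [A, B, Finset.mem_union, Finset.mem_filter, Finset.mem_univ, true_and,
        Finset.mem_singleton]
      by_cases hi : i = i0
      · exact Or.inr hi
      · left
        by_cases hx : ∃ x, (s i).2 x = []
        · exact Or.inr ⟨hi, hx⟩
        · exact Or.inl ⟨hi, fun x hx' => hx ⟨x, hx'⟩⟩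
    have h1 := Finset.card_le_card this
    have h2 := Finset.card_union_le (A ∪ B) {i0}
    have h3 := Finset.card_union_le A B
    rw [Finset.card_singleton] at h2
    rw [Finset.card_univ] at h1
    omega
  have hA : ∀ i : A, i.1 ≠ i0 ∧ ∀ x, (s i.1).2 x ≠ [] := by
    intro i
    have := i.2
    simpa only [A, Finset.mem_filter, Finset.mem_univ, true_and] using this
  obtain ⟨M, hM1, hM2, hM3⟩ := minimal_count (ι := A) (fun i => (s i.1).1) (fun i => (s i.1).2)
    (fun i => lam i.1) (fun i => hl i.1)
    (fun i j hij hk => hdist i.1 j.1 (fun h => hij (Subtype.ext h)) (ker_eq (hl i.1) (hl j.1) hk))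
    (fun i x => (hA i).2 x) _ hkl
    (fun i => minors_vanish (hl i.1) (hsE i.1) (hsF i.1 (hA i).1) k l)
  have := antichain_bound E F k l M (fun γ hγ => hM1 hγ) hM2
  rw [Fintype.card_coe] at hM3
  omega

lemma main_aux {n m : ℕ} (hn : 1 ≤ n) (hm : 2 ≤ m)
    (E : Fin m → List (Fin n) × List (Fin n)) (hinj : Function.Injective E)
    (hsind : ∀ S : Set (List (Fin n) × List (Fin n)), S ⊂ Set.range E →
      ∃ (c : ℕ) (g : Fin n → List (Fin c)),
        IsSolution g S ∧ morphRank g = n - 1 ∧ ∃ i, ¬ IsSolutionE g (E i)) (p : Fin m) :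
    ∃ k l : Fin n, k < l ∧
      m ≤ 2 * (((E p).1.count k + (E p).2.count k) + ((E p).1.count l + (E p).2.count l)) + 2 ∧
      ((∃ (c : ℕ) (g : Fin n → List (Fin c)),
        (∀ i, IsSolutionE g (E i)) ∧ morphRank g = n - 1) →
      m ≤ 2 * (((E p).1.count k + (E p).2.count k) + ((E p).1.count l + (E p).2.count l)) + 1) := by
  classical
  have hex : ∀ j : Fin m, ∃ s : Mor n, ∃ lam, Line s.2 lam ∧
      (∀ i, i ≠ j → IsSolutionE s.2 (E i)) ∧ ¬ IsSolutionE s.2 (E j) := by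
    intro j
    obtain ⟨c, g, h1, h2, i, h3⟩ := hsind (Set.range E \ {E j}) (by
      refine ⟨Set.diff_subset, fun h => ?_⟩
      exact (h ⟨j, rfl⟩).2 rfl)
    obtain ⟨lam, hlam⟩ := exists_line hn g h2
    have h4 : ∀ i, i ≠ j → IsSolutionE g (E i) := fun i hi =>
      h1 _ ⟨⟨i, rfl⟩, fun h => hi (hinj h)⟩
    have hij : i = j := by
      by_contra hne
      exact h3 (h4 i hne)
    subst hij
    exact ⟨⟨c, g⟩, lam, hlam, h4, h3⟩
  choose s lam hl hs hns using hex
  have hE : ∀ j, (E j).1 ≠ (E j).2 := by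
    intro j h
    apply hns j
    unfold IsSolutionE
    rw [h]
  have hdist : ∀ i j, i ≠ p → j ≠ p → i ≠ j → ¬ ∀ z, Ker (s i).2 z ↔ Ker (s j).2 z := by
    intro i j hi hj hij hk
    exact hns j (same_ker (hl i) (hl j) hk (hE p) (hs i p (Ne.symm hi)) (hs j p (Ne.symm hj))
      (hs i j (Ne.symm hij)))
  obtain ⟨i0, hi0, her⟩ : ∃ i0, i0 ≠ p ∧ ((∃ x, (s i0).2 x = []) ∨
      ∀ j, j ≠ p → ¬ ∃ x, (s j).2 x = []) := by
    by_cases h : ∃ i, i ≠ p ∧ ∃ x, (s i).2 x = []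
    · obtain ⟨i, hi, hx⟩ := h
      exact ⟨i, hi, Or.inl hx⟩
    · haveI : Nontrivial (Fin m) := Fin.nontrivial_iff_two_le.2 hm
      obtain ⟨i, hi⟩ := exists_ne p
      exact ⟨i, hi, Or.inr fun j hj hx => h ⟨j, hj, hx⟩⟩
  obtain ⟨k, l, hkl⟩ : ∃ k l, vec (E p) k * vec (E i0) l - vec (E p) l * vec (E i0) k ≠ 0 := by
    by_contra hcon
    push Not at hcon
    exact hns i0 (transfer_sol (E := E p) (fun k l => by rw [hcon, map_zero])
      (vec_ne_zero (hl i0) (hE p)) (hs i0 p (Ne.symm hi0)))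
  have hne : k ≠ l := by
    rintro rfl
    exact hkl (sub_self _)
  let ι := {j : Fin m // j ≠ p}
  have hcard : Fintype.card ι = m - 1 := by
    simp only [ι, ne_eq, Fintype.card_subtype_compl, Fintype.card_fin, Fintype.card_unique]
  have b1 := family_bound (ι := ι) (fun j => s j.1) (fun j => lam j.1) (fun j => hl j.1)
    (fun i j hij => hdist i.1 j.1 i.2 j.2 fun h => hij (Subtype.ext h)) (E p) (E i0) (hE p)
    (fun i => hs i.1 p (Ne.symm i.2)) ⟨i0, hi0⟩
    (fun i hi => hs i.1 i0 fun h => hi (Subtype.ext h.symm))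
    (her.imp id fun h i j hx _ => absurd hx (h i.1 i.2)) k l hkl
  rw [hcard] at b1
  have b2 : (∃ (c : ℕ) (g : Fin n → List (Fin c)),
        (∀ i, IsSolutionE g (E i)) ∧ morphRank g = n - 1) → m ≤
      2 * (((E p).1.count k + (E p).2.count k) + ((E p).1.count l + (E p).2.count l)) + 1 := by
    rintro ⟨c, g, hg, hr⟩
    obtain ⟨lam0, hl0⟩ := exists_line hn g hr
    have hd0 : ∀ j, j ≠ p → ¬ ∀ z, Ker g z ↔ Ker (s j).2 z := by
      intro j hj hk
      exact hns j (same_ker hl0 (hl j) hk (hE p) (hg p) (hs j p (Ne.symm hj)) (hg j))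
    let s' : Option ι → Mor n := fun o => match o with
      | none => ⟨c, g⟩
      | some j => s j.1
    let lam' : Option ι → Fin n → ℚ := fun o => match o with
      | none => lam0
      | some j => lam j.1
    have b := family_bound (ι := Option ι) s' lam'
      (by rintro (_ | j); exacts [hl0, hl j.1])
      (by
        rintro (_ | i) (_ | j) hij
        · exact absurd rfl hij
        · exact hd0 j.1 j.2
        · exact fun h => hd0 i.1 i.2 fun z => (h z).symm
        · exact hdist i.1 j.1 i.2 j.2 fun h => hij (congrArg some (Subtype.ext h)))
      (E p) (E i0) (hE p)
      (by rintro (_ | i); exacts [hg p, hs i.1 p (Ne.symm i.2)]) (some ⟨i0, hi0⟩)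
      (by
        rintro (_ | i) hi
        · exact hg i0
        · exact hs i.1 i0 fun h => hi (congrArg some (Subtype.ext h.symm)))
      (by
        refine her.imp id fun h => ?_
        rintro (_ | i) (_ | j) hx hy
        · rfl
        · exact absurd hy (h j.1 j.2)
        · exact absurd hx (h i.1 i.2)
        · exact absurd hx (h i.1 i.2)) k l hkl
    rw [Fintype.card_option, hcard] at b
    omega
  rcases lt_or_gt_of_ne hne with h | h
  · exact ⟨k, l, h, by omega, b2⟩
  · exact ⟨l, k, h, by omega, fun hh => by have := b2 hh; omega⟩

lemma count_two_le {n : ℕ} (w : List (Fin n)) (k l : Fin n) (h : k ≠ l) :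
    w.count k + w.count l ≤ w.length := by
  induction w with
  | nil => simp
  | cons c w ih =>
    simp only [List.count_cons, List.length_cons, beq_iff_eq]
    split_ifs with h1 h2 <;> first | omega | exact absurd (h1.symm.trans h2) h

/-- bounds on the size of a strongly independent system
`T = {E₁, …, E_m}` of word equations in `n` unknowns. -/
theorem bound_strongly_independent_system {n m : ℕ} (hm : 2 ≤ m)
    (E : Fin m → List (Fin n) × List (Fin n)) (hinj : Function.Injective E)
    (hsind : ∀ S : Set (List (Fin n) × List (Fin n)), S ⊂ Set.range E →
      ∃ (c : ℕ) (g : Fin n → List (Fin c)),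
        IsSolution g S ∧ morphRank g = n - 1 ∧ ∃ i, ¬ IsSolutionE g (E i)) :
    (m ≤ ((E ⟨0, by omega⟩).1.length + (E ⟨0, by omega⟩).2.length)
        + ((E ⟨1, by omega⟩).1.length + (E ⟨1, by omega⟩).2.length) + 2) ∧
    (∃ k ℓ : Fin n, k < ℓ ∧
      m ≤ 2 * (((E ⟨0, by omega⟩).1.count k + (E ⟨0, by omega⟩).2.count k)
          + ((E ⟨0, by omega⟩).1.count ℓ + (E ⟨0, by omega⟩).2.count ℓ)) + 2) ∧
    ((∃ (c : ℕ) (g : Fin n → List (Fin c)),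
        (∀ i, IsSolutionE g (E i)) ∧ morphRank g = n - 1) →
      (m ≤ ((E ⟨0, by omega⟩).1.length + (E ⟨0, by omega⟩).2.length)
          + ((E ⟨1, by omega⟩).1.length + (E ⟨1, by omega⟩).2.length) + 1) ∧
      (∃ k ℓ : Fin n, k < ℓ ∧
        m ≤ 2 * (((E ⟨0, by omega⟩).1.count k + (E ⟨0, by omega⟩).2.count k)
            + ((E ⟨0, by omega⟩).1.count ℓ + (E ⟨0, by omega⟩).2.count ℓ)) + 1)) := by
  have hn : 1 ≤ n := by
    rcases Nat.eq_zero_or_pos n with rfl | h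
    · exfalso
      have h1 : ∀ w : List (Fin 0), w = [] := fun w => by
        cases w with
        | nil => rfl
        | cons a w => exact a.elim0
      have h2 : E ⟨0, by omega⟩ = E ⟨1, by omega⟩ := Prod.ext ((h1 _).trans (h1 _).symm)
        ((h1 _).trans (h1 _).symm)
      have := hinj h2
      simp at this
    · exact h
  obtain ⟨k, l, hkl, h1, h2⟩ := main_aux hn hm E hinj hsind ⟨0, by omega⟩
  obtain ⟨k', l', hkl', h1', h2'⟩ := main_aux hn hm E hinj hsind ⟨1, by omega⟩
  have c1 := count_two_le (E ⟨0, by omega⟩).1 k l hkl.ne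
  have c2 := count_two_le (E ⟨0, by omega⟩).2 k l hkl.ne
  have c3 := count_two_le (E ⟨1, by omega⟩).1 k' l' hkl'.ne
  have c4 := count_two_le (E ⟨1, by omega⟩).2 k' l' hkl'.ne
  refine ⟨by omega, ⟨k, l, hkl, h1⟩, fun hsol => ?_⟩
  have h3 := h2 hsol
  have h4 := h2' hsol
  exact ⟨by omega, ⟨k, l, hkl, h3⟩⟩

end WordEquations
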